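/- arXiv:2505.14023 — 4 statements merged into one kernel-verified Lean document; each statement's English description precedes it below -/
import Mathlib

section
/- Let d ≥ 1, let λ ∈ ℝ^d, let r > 0, and let B denote the closed ball in ℝ^d of center λ and radius r. Let (B_j)_{j∈ℕ} be a sequence of compact convex subsets of B whose d-dimensional Lebesgue measures converge to the Lebesgue measure of B. Then for all sufficiently large j, the point λ lies in the topological interior of B_j. -/
/-- If `B j` is a sequence of compact convex subsets of the closed ball of
center `p` and radius `r > 0` whose volumes converge to the volume of the ball, then `p`
lies in the interior of `B j` for all sufficiently large `j`. -/
theorem center_mem_interior_of_volume_tendsto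
    (d : ℕ) (hd : 1 ≤ d) (p : EuclideanSpace ℝ (Fin d)) (r : ℝ) (hr : 0 < r)
    (B : ℕ → Set (EuclideanSpace ℝ (Fin d)))
    (hsub : ∀ j, B j ⊆ Metric.closedBall p r)
    (hcpt : ∀ j, IsCompact (B j)) (hconv : ∀ j, Convex ℝ (B j))
    (hvol : Filter.Tendsto (fun j => MeasureTheory.volume (B j)) Filter.atTop
      (nhds (MeasureTheory.volume (Metric.closedBall p r)))) :
    ∃ J : ℕ, ∀ j ≥ J, p ∈ interior (B j) := by
  have hV0 : MeasureTheory.volume (Metric.closedBall p r) ≠ 0 :=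
    (Metric.measure_closedBall_pos MeasureTheory.volume p hr).ne'
  have hVt : MeasureTheory.volume (Metric.closedBall p r) ≠ ⊤ :=
    MeasureTheory.measure_closedBall_lt_top.ne
  have hev := hvol.eventually (lt_mem_nhds (ENNReal.half_lt_self hV0 hVt))
  obtain ⟨J, hJ⟩ := Filter.eventually_atTop.1 hev
  refine ⟨J, fun j hj => ?_⟩
  by_contra hp
  have h1 := hJ j hj
  apply absurd h1
  rw [not_lt]
  have hUconv : Convex ℝ (interior (B j)) := (hconv j).interior
  have hBU : MeasureTheory.volume (B j) ≤ MeasureTheory.volume (interior (B j)) := by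
    calc MeasureTheory.volume (B j)
        ≤ MeasureTheory.volume (interior (B j) ∪ frontier (B j)) := by
          apply MeasureTheory.measure_mono
          rw [← closure_eq_interior_union_frontier]
          exact subset_closure
      _ ≤ MeasureTheory.volume (interior (B j)) + MeasureTheory.volume (frontier (B j)) :=
          MeasureTheory.measure_union_le _ _
      _ = MeasureTheory.volume (interior (B j)) := by
          rw [(hconv j).addHaar_frontier MeasureTheory.volume, add_zero]
  -- the reflected copy of the interior through `p`
  have hmp := MeasureTheory.Measure.measurePreserving_sub_left
    (MeasureTheory.volume : MeasureTheory.Measure (EuclideanSpace ℝ (Fin d))) (p + p)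
  have hmeas : MeasurableSet (interior (B j)) := isOpen_interior.measurableSet
  have hrefl := hmp.measure_preimage hmeas.nullMeasurableSet
  have hdisj : Disjoint (interior (B j)) ((fun x => p + p - x) ⁻¹' interior (B j)) := by
    rw [Set.disjoint_left]
    intro x hx hx'
    apply hp
    have := hUconv hx hx' (a := 1/2) (b := 1/2) (by norm_num) (by norm_num) (by norm_num)
    convert this using 1
    module
  have hsub2 : interior (B j) ∪ ((fun x => p + p - x) ⁻¹' interior (B j))
      ⊆ Metric.closedBall p r := by
    rintro x (hx | hx)
    · exact hsub j (interior_subset hx)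
    · have h := hsub j (interior_subset hx)
      rw [mem_closedBall_iff_norm] at h ⊢
      have e : -(x - p) = p + p - x - p := by abel
      rw [← norm_neg, e]
      exact h
  have hsum := MeasureTheory.measure_mono (μ := MeasureTheory.volume) hsub2
  rw [MeasureTheory.measure_union hdisj (hmp.measurable hmeas), hrefl, ← mul_two] at hsum
  refine hBU.trans ?_
  rw [ENNReal.le_div_iff_mul_le (by simp) (by simp)]
  exact hsum
end

section
/- Let d ≥ 1 and let Δ₁ and Δ₂ be convex bodies in ℝ^d, so that the Minkowski sum Δ₁ + Δ₂ = {x + y : x ∈ Δ₁, y ∈ Δ₂} is again a convex body. Let G₁ : Δ₁ → ℝ, G₂ : Δ₂ → ℝ, and G : Δ₁ + Δ₂ → ℝ be concave functions satisfying the superadditivity condition G(λ₁ + λ₂) ≥ G₁(λ₁) + G₂(λ₂) for all λ₁ ∈ Δ₁ and λ₂ ∈ Δ₂. Set v_i := ∫_{Δ_i} max(G_i(λ), 0) dλ for i = 1, 2 and v := ∫_{Δ₁+Δ₂} max(G(λ), 0) dλ, the integrals being with respect to d-dimensional Lebesgue measure. If v₁ > 0 and v₂ > 0, then v^{1/(d+1)}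 ≥ v₁^{1/(d+1)} + v₂^{1/(d+1)}. -/
section PLaux
open MeasureTheory Set
open scoped ENNReal Pointwise

def PLprop {E : Type*} [AddCommGroup E] [Module ℝ E] [MeasurableSpace E] (μ : Measure E) : Prop :=
  ∀ t : ℝ, 0 < t → t < 1 → ∀ f g h : E → ℝ≥0∞, Measurable f → Measurable g → Measurable h →
    (∀ x y, f x ^ (1 - t) * g y ^ t ≤ h ((1 - t) • x + t • y)) →
    (∫⁻ x, f x ∂μ) ^ (1 - t) * (∫⁻ x, g x ∂μ) ^ t ≤ ∫⁻ x, h x ∂μ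

theorem PLprop.map {E F : Type*} [AddCommGroup E] [Module ℝ E] [MeasurableSpace E]
    [AddCommGroup F] [Module ℝ F] [MeasurableSpace F] {μ : Measure E} {ν : Measure F}
    (hμ : PLprop μ) (φ : E → F) (hφ : MeasurePreserving φ μ ν)
    (hlin : ∀ (a b : ℝ) (x y : E), φ (a • x + b • y) = a • φ x + b • φ y) : PLprop ν := by
  intro t ht0 ht1 f g h hf hg hh H
  rw [← hφ.lintegral_comp hf, ← hφ.lintegral_comp hg, ← hφ.lintegral_comp hh]
  refine hμ t ht0 ht1 _ _ _ (hf.comp hφ.measurable) (hg.comp hφ.measurable)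
    (hh.comp hφ.measurable) ?_
  intro x y
  rw [hlin]
  exact H _ _

theorem PLprop.prod {E F : Type*} [AddCommGroup E] [Module ℝ E] [MeasurableSpace E]
    [AddCommGroup F] [Module ℝ F] [MeasurableSpace F] {μ : Measure E} {ν : Measure F}
    [SFinite ν] (hμ : PLprop μ) (hν : PLprop ν) : PLprop (μ.prod ν) := by
  intro t ht0 ht1 f g h hf hg hh H
  rw [lintegral_prod _ hf.aemeasurable, lintegral_prod _ hg.aemeasurable,
    lintegral_prod _ hh.aemeasurable]
  refine hμ t ht0 ht1 _ _ _ hf.lintegral_prod_right' hg.lintegral_prod_right'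
    hh.lintegral_prod_right' ?_
  intro x y
  refine hν t ht0 ht1 _ _ _ (hf.comp measurable_prodMk_left) (hg.comp measurable_prodMk_left)
    (hh.comp measurable_prodMk_left) ?_
  intro u v
  exact H (x, u) (y, v)

/-- One-dimensional Brunn-Minkowski inequality. -/
theorem bm_one_compact {K L : Set ℝ} (hK : IsCompact K) (hL : IsCompact L)
    (hK' : K.Nonempty) (hL' : L.Nonempty) : volume K + volume L ≤ volume (K + L) := by
  obtain ⟨k, hk, hkm⟩ := hK.exists_isGreatest hK'
  obtain ⟨l, hl, hlm⟩ := hL.exists_isLeast hL'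
  have h1 : volume ((fun x => x + l) '' K) = volume K := by simp
  have h2 : volume ((fun x => k + x) '' L) = volume L := by simp
  have hd : AEDisjoint volume ((fun x => x + l) '' K) ((fun x => k + x) '' L) := by
    refine measure_mono_null (t := {k + l}) ?_ (by simp)
    rintro _ ⟨⟨x, hx, rfl⟩, ⟨y, hy, hxy⟩⟩
    have := hkm hx
    have := hlm hy
    simp only at hxy ⊢
    rw [mem_singleton_iff]
    linarith
  have hm : MeasurableSet ((fun x => k + x) '' L) :=
    (hL.image (by fun_prop)).measurableSet
  rw [← h1, ← h2, ← measure_union₀ hm.nullMeasurableSet hd]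
  apply measure_mono
  apply union_subset
  · rintro _ ⟨x, hx, rfl⟩
    exact add_mem_add hx hl
  · rintro _ ⟨x, hx, rfl⟩
    exact add_mem_add hk hx

theorem bm_one {A B : Set ℝ} (hA : MeasurableSet A) (hB : MeasurableSet B)
    (hA' : A.Nonempty) (hB' : B.Nonempty) : volume A + volume B ≤ volume (A + B) := by
  obtain ⟨a, ha⟩ := hA'
  obtain ⟨b, hb⟩ := hB'
  rw [hA.measure_eq_iSup_isCompact, hB.measure_eq_iSup_isCompact]
  simp only [iSup_and']
  refine ENNReal.biSup_add_biSup_le' ⟨∅, by simp⟩ ⟨∅, by simp⟩ ?_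
  rintro K ⟨hKA, hK⟩ L ⟨hLB, hL⟩
  calc volume K + volume L ≤ volume (insert a K) + volume (insert b L) := by
        gcongr <;> exact subset_insert _ _
    _ ≤ volume (insert a K + insert b L) :=
        bm_one_compact (hK.insert a) (hL.insert b) (insert_nonempty _ _) (insert_nonempty _ _)
    _ ≤ _ := measure_mono (add_subset_add (insert_subset ha hKA) (insert_subset hb hLB))

theorem bm_one_t {A B C : Set ℝ} {t : ℝ} (ht0 : 0 < t) (ht1 : t < 1)
    (hA : MeasurableSet A) (hB : MeasurableSet B)
    (hA' : A.Nonempty) (hB' : B.Nonempty)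
    (H : ∀ x ∈ A, ∀ y ∈ B, (1 - t) * x + t * y ∈ C) :
    ENNReal.ofReal (1 - t) * volume A + ENNReal.ofReal t * volume B ≤ volume C := by
  have h1 : volume ((1 - t) • A) = ENNReal.ofReal (1 - t) * volume A := by
    rw [Measure.addHaar_smul]; simp [abs_of_pos (sub_pos.2 ht1)]
  have h2 : volume (t • B) = ENNReal.ofReal t * volume B := by
    rw [Measure.addHaar_smul]; simp [abs_of_pos ht0]
  rw [← h1, ← h2]
  refine (bm_one (hA.const_smul₀ _) (hB.const_smul₀ _) hA'.smul_set hB'.smul_set).trans ?_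
  apply measure_mono
  rintro _ ⟨_, ⟨x, hx, rfl⟩, _, ⟨y, hy, rfl⟩, rfl⟩
  exact H x hx y hy

theorem pl_one_real {t : ℝ} (ht0 : 0 < t) (ht1 : t < 1) (f g h : ℝ → ℝ)
    (hf : Measurable f) (hg : Measurable g) (hh : Measurable h)
    (f0 : ∀ x, 0 ≤ f x) (g0 : ∀ x, 0 ≤ g x) (h0 : ∀ x, 0 ≤ h x)
    (f1 : ∀ x, f x ≤ 1) (g1 : ∀ x, g x ≤ 1)
    (fs : ∀ s < 1, ∃ x, s < f x) (gs : ∀ s < 1, ∃ x, s < g x)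
    (H : ∀ x y, min (f x) (g y) ≤ h ((1 - t) * x + t * y)) :
    ENNReal.ofReal (1 - t) * (∫⁻ x, ENNReal.ofReal (f x)) +
      ENNReal.ofReal t * (∫⁻ x, ENNReal.ofReal (g x)) ≤ ∫⁻ x, ENNReal.ofReal (h x) := by
  rw [lintegral_eq_lintegral_meas_lt _ (.of_forall f0) hf.aemeasurable,
    lintegral_eq_lintegral_meas_lt _ (.of_forall g0) hg.aemeasurable,
    lintegral_eq_lintegral_meas_lt _ (.of_forall h0) hh.aemeasurable]
  have mf : Measurable fun s : ℝ => volume {a | s < f a} :=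
    Antitone.measurable fun a b hab => measure_mono fun x hx => lt_of_le_of_lt hab hx
  have mg : Measurable fun s : ℝ => volume {a | s < g a} :=
    Antitone.measurable fun a b hab => measure_mono fun x hx => lt_of_le_of_lt hab hx
  rw [← lintegral_const_mul _ mf, ← lintegral_const_mul _ mg,
    ← lintegral_add_left (mf.const_mul _)]
  apply lintegral_mono
  intro s
  by_cases hs : s < 1
  · refine bm_one_t ht0 ht1 (measurableSet_lt measurable_const hf)
      (measurableSet_lt measurable_const hg) (fs s hs) (gs s hs) ?_
    intro x hx y hy
    exact lt_of_lt_of_le (lt_min hx hy) (H x y)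
  · have e1 : {a | s < f a} = ∅ := by
      ext x; simp; exact (f1 x).trans (not_lt.1 hs)
    have e2 : {a | s < g a} = ∅ := by
      ext x; simp; exact (g1 x).trans (not_lt.1 hs)
    simp [e1, e2]

theorem ennreal_amgm {t : ℝ} (ht0 : 0 < t) (ht1 : t < 1) (p q : ℝ≥0∞) :
    p ^ (1 - t) * q ^ t ≤ ENNReal.ofReal (1 - t) * p + ENNReal.ofReal t * q := by
  have h1 : 0 < 1 - t := sub_pos.2 ht1
  by_cases hp : p = ⊤
  · rw [hp, ENNReal.mul_top (by simpa using ht1)]; simp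
  by_cases hq : q = ⊤
  · rw [hq, ENNReal.mul_top (by simpa using ht0)]; simp
  lift p to NNReal using hp
  lift q to NNReal using hq
  have := NNReal.geom_mean_le_arith_mean2_weighted (Real.toNNReal (1 - t)) (Real.toNNReal t) p q
    (by rw [← Real.toNNReal_add h1.le ht0.le]; simp)
  rw [Real.coe_toNNReal _ h1.le, Real.coe_toNNReal _ ht0.le] at this
  rw [← ENNReal.coe_rpow_of_nonneg _ h1.le, ← ENNReal.coe_rpow_of_nonneg _ ht0.le]
  unfold ENNReal.ofReal
  exact_mod_cast this

theorem ennreal_min_le {t : ℝ} (ht0 : 0 < t) (ht1 : t < 1) (p q : ℝ≥0∞) :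
    min p q ≤ p ^ (1 - t) * q ^ t := by
  have h1 : 0 < 1 - t := sub_pos.2 ht1
  calc min p q = (min p q) ^ (1 - t) * (min p q) ^ t := by
        rw [← ENNReal.rpow_add_of_nonneg _ _ h1.le ht0.le]; simp
    _ ≤ _ := by
      gcongr
      · exact min_le_left _ _
      · exact min_le_right _ _

theorem pl_one_bdd {t : ℝ} (ht0 : 0 < t) (ht1 : t < 1) (f g h : ℝ → ℝ≥0∞)
    (hf : Measurable f) (hg : Measurable g) (hh : Measurable h)
    (fb : ⨆ x, f x ≠ ⊤) (gb : ⨆ x, g x ≠ ⊤)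
    (H : ∀ x y, f x ^ (1 - t) * g y ^ t ≤ h ((1 - t) • x + t • y)) :
    (∫⁻ x, f x) ^ (1 - t) * (∫⁻ x, g x) ^ t ≤ ∫⁻ x, h x := by
  have h1 : 0 < 1 - t := sub_pos.2 ht1
  by_cases fa : ⨆ x, f x = 0
  · have : ∀ x, f x = 0 := by simpa using fa
    simp [this, h1]
  by_cases ga : ⨆ x, g x = 0
  · have : ∀ x, g x = 0 := by simpa using ga
    simp [this, ht0]
  set a := ⨆ x, f x with ha
  set b := ⨆ x, g x with hb
  set c := a ^ (1 - t) * b ^ t with hc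
  have c0 : c ≠ 0 := by
    refine mul_ne_zero ?_ ?_ <;> simp [fa, ga, fb, gb, ENNReal.rpow_eq_zero_iff]
  have ct : c ≠ ⊤ := by
    refine ENNReal.mul_ne_top ?_ ?_
    · exact ENNReal.rpow_ne_top_of_nonneg h1.le fb
    · exact ENNReal.rpow_ne_top_of_nonneg ht0.le gb
  have key : ∀ p q : ℝ≥0∞, (p / a) ^ (1 - t) * (q / b) ^ t = (p ^ (1 - t) * q ^ t) / c := by
    intro p q
    rw [ENNReal.div_rpow_of_nonneg _ _ h1.le, ENNReal.div_rpow_of_nonneg _ _ ht0.le, hc]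
    simp only [div_eq_mul_inv]
    rw [ENNReal.mul_inv]
    · ring
    · right; exact ENNReal.rpow_ne_top_of_nonneg ht0.le gb
    · left; exact ENNReal.rpow_ne_top_of_nonneg h1.le fb
  have fle : ∀ x, f x / a ≤ 1 := fun x => ENNReal.div_le_of_le_mul (by simpa using le_iSup f x)
  have gle : ∀ x, g x / b ≤ 1 := fun x => ENNReal.div_le_of_le_mul (by simpa using le_iSup g x)
  have fT : ∀ x, f x / a ≠ ⊤ := fun x => ((fle x).trans_lt ENNReal.one_lt_top).ne
  have gT : ∀ x, g x / b ≠ ⊤ := fun x => ((gle x).trans_lt ENNReal.one_lt_top).ne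
  have hT : ∀ x, min (h x / c) 1 ≠ ⊤ := fun x =>
    ((min_le_right _ _).trans_lt ENNReal.one_lt_top).ne
  have sup : ∀ (k : ℝ → ℝ≥0∞) (m : ℝ≥0∞), m = ⨆ x, k x → m ≠ 0 → m ≠ ⊤ → (∀ x, k x / m ≠ ⊤) →
      ∀ s < (1 : ℝ), ∃ x, s < (k x / m).toReal := by
    intro k m hm m0 mT kT s hs
    rcases lt_or_ge s 0 with hs0 | hs0
    · exact ⟨0, hs0.trans_le ENNReal.toReal_nonneg⟩
    have : ENNReal.ofReal s * m < ⨆ x, k x := by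
      rw [← hm]
      conv_rhs => rw [← one_mul m]
      exact ENNReal.mul_lt_mul_left m0 mT (by simpa using hs)
    obtain ⟨x, hx⟩ := lt_iSup_iff.1 this
    refine ⟨x, ?_⟩
    rw [← ENNReal.ofReal_lt_iff_lt_toReal hs0 (kT x)]
    exact (ENNReal.lt_div_iff_mul_lt (.inl m0) (.inl mT)).2 hx
  have main := pl_one_real ht0 ht1 (fun x => (f x / a).toReal) (fun x => (g x / b).toReal)
    (fun x => (min (h x / c) 1).toReal) (hf.div_const _).ennreal_toReal
    (hg.div_const _).ennreal_toReal ((hh.div_const _).min measurable_const).ennreal_toReal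
    (fun _ => ENNReal.toReal_nonneg) (fun _ => ENNReal.toReal_nonneg)
    (fun _ => ENNReal.toReal_nonneg)
    (fun x => ENNReal.toReal_le_of_le_ofReal zero_le_one (by simpa using fle x))
    (fun x => ENNReal.toReal_le_of_le_ofReal zero_le_one (by simpa using gle x))
    (sup f a ha fa fb fT) (sup g b hb ga gb gT) (by
      intro x y
      rw [← ENNReal.toReal_min (fT x) (gT y)]
      refine ENNReal.toReal_mono (hT _) (le_min ?_ ((min_le_left _ _).trans (fle x)))
      refine (ennreal_min_le ht0 ht1 _ _).trans ?_
      rw [key]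
      exact ENNReal.div_le_div_right (H x y) _)
  simp only [ENNReal.ofReal_toReal (fT _), ENNReal.ofReal_toReal (gT _),
    ENNReal.ofReal_toReal (hT _)] at main
  have m2 := (ennreal_amgm ht0 ht1 _ _).trans main
  have m3 := m2.trans (lintegral_mono (fun x => min_le_left (h x / c) 1))
  simp only [div_eq_mul_inv] at m3 key
  rw [lintegral_mul_const _ hf, lintegral_mul_const _ hg, lintegral_mul_const _ hh, key] at m3
  have := mul_le_mul_left m3 c
  rwa [mul_assoc _ c⁻¹ c, mul_assoc _ c⁻¹ c, ENNReal.inv_mul_cancel c0 ct, mul_one, mul_one] at this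

theorem trunc_tendsto (f : ℝ → ℝ≥0∞) (hf : Measurable f) :
    Filter.Tendsto (fun n : ℕ => ∫⁻ x, min (f x) n) Filter.atTop (nhds (∫⁻ x, f x)) := by
  refine lintegral_tendsto_of_tendsto_of_monotone
    (fun n => (hf.min measurable_const).aemeasurable) ?_ ?_
  · refine .of_forall fun x m n hmn => ?_
    dsimp only
    gcongr
  · refine .of_forall fun x => ?_
    have : Filter.Tendsto (fun n : ℕ => min (f x) (n : ℝ≥0∞)) Filter.atTop
      (nhds (min (f x) ⊤)) := tendsto_const_nhds.min ENNReal.tendsto_nat_nhds_top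
    simpa using this

theorem pl_one : PLprop (volume : Measure ℝ) := by
  intro t ht0 ht1 f g h hf hg hh H
  have h1 : 0 < 1 - t := sub_pos.2 ht1
  by_cases f0 : ∫⁻ x, f x = 0
  · simp [f0, h1]
  by_cases g0 : ∫⁻ x, g x = 0
  · simp [g0, ht0]
  have tf := (trunc_tendsto f hf).ennrpow_const (1 - t)
  have tg := (trunc_tendsto g hg).ennrpow_const t
  refine le_of_tendsto (ENNReal.Tendsto.mul tf (.inl ?_) tg (.inl ?_)) (.of_forall fun n => ?_)
  · simp [ENNReal.rpow_eq_zero_iff, f0, h1, h1.le, not_lt.2 h1.le]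
  · simp [ENNReal.rpow_eq_zero_iff, g0, ht0, ht0.le, not_lt.2 ht0.le]
  · have bd : ∀ k : ℝ → ℝ≥0∞, ⨆ x, min (k x) (n : ℝ≥0∞) ≠ ⊤ := fun k =>
      ((iSup_le fun x => min_le_right _ _).trans_lt (ENNReal.natCast_lt_top n)).ne
    refine pl_one_bdd ht0 ht1 _ _ h (hf.min measurable_const) (hg.min measurable_const) hh
      (bd f) (bd g) ?_
    intro x y
    refine le_trans ?_ (H x y)
    gcongr <;> exact min_le_left _ _

theorem pl_pi (n : ℕ) : PLprop (volume : Measure (Fin n → ℝ)) := by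
  induction n with
  | zero =>
    intro t ht0 ht1 f g h hf hg hh H
    rw [volume_pi, Measure.pi_of_empty _ 0, lintegral_dirac' _ hf, lintegral_dirac' _ hg,
      lintegral_dirac' _ hh]
    convert H 0 0
  | succ n ih =>
    refine (pl_one.prod ih).map _
      (volume_preserving_piFinSuccAbove (fun _ : Fin (n + 1) => ℝ) 0).symm ?_
    intro a b x y
    ext i
    refine Fin.cases ?_ (fun j => ?_) i <;> simp [MeasurableEquiv.piFinSuccAbove]

theorem pl_euclidean (n : ℕ) : PLprop (volume : Measure (EuclideanSpace ℝ (Fin n))) :=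
  (pl_pi n).map _ (PiLp.volume_preserving_toLp (Fin n)) (by intros; rfl)

theorem bm_prod (d : ℕ) (K₁ K₂ K : Set (EuclideanSpace ℝ (Fin d) × ℝ))
    (h₁ : MeasurableSet K₁) (h₂ : MeasurableSet K₂) (h : MeasurableSet K)
    (H : ∀ x ∈ K₁, ∀ y ∈ K₂, x + y ∈ K) {a b : ℝ} (ha : 0 < a) (hb : 0 < b)
    (hK₁ : volume K₁ = ENNReal.ofReal (a ^ (d + 1)))
    (hK₂ : volume K₂ = ENNReal.ofReal (b ^ (d + 1))) :
    ENNReal.ofReal ((a + b) ^ (d + 1)) ≤ volume K := by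
  have hab : 0 < a + b := add_pos ha hb
  have pl : PLprop (volume : Measure (EuclideanSpace ℝ (Fin d) × ℝ)) :=
    (pl_euclidean d).prod pl_one
  have haar : (volume : Measure (EuclideanSpace ℝ (Fin d) × ℝ)).IsAddHaarMeasure := by
    rw [Measure.volume_eq_prod]; infer_instance
  have fr : Module.finrank ℝ (EuclideanSpace ℝ (Fin d) × ℝ) = d + 1 := by simp
  have vol : ∀ (r : ℝ) (S : Set (EuclideanSpace ℝ (Fin d) × ℝ)), 0 < r → MeasurableSet S →
      ∫⁻ x, ((fun x => r • x) ⁻¹' S).indicator (fun _ => (1 : ℝ≥0∞)) x =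
        ENNReal.ofReal ((r ^ (d + 1))⁻¹) * volume S := by
    intro r S hr hS
    rw [lintegral_indicator_const (hS.preimage (measurable_const_smul r)), one_mul,
      Measure.addHaar_preimage_smul _ hr.ne', fr, abs_of_pos (by positivity)]
  have meas : ∀ (r : ℝ) (S : Set (EuclideanSpace ℝ (Fin d) × ℝ)), MeasurableSet S →
      Measurable (((fun x => r • x) ⁻¹' S).indicator (fun _ => (1 : ℝ≥0∞))) := fun r S hS =>
    measurable_const.indicator (hS.preimage (measurable_const_smul r))
  have ht1 : b / (a + b) < 1 := by rw [div_lt_one hab]; linarith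
  have ht0 : 0 < b / (a + b) := by positivity
  have main := pl (b / (a + b)) ht0 ht1 _ _ _ (meas a K₁ h₁) (meas b K₂ h₂) (meas (a + b) K h) (by
    intro x y
    by_cases hx : a • x ∈ K₁
    · by_cases hy : b • y ∈ K₂
      · have : (a + b) • ((1 - b / (a + b)) • x + (b / (a + b)) • y) ∈ K := by
          have e : (a + b) • ((1 - b / (a + b)) • x + (b / (a + b)) • y) = a • x + b • y := by
            rw [smul_add, smul_smul, smul_smul]
            congr 2
            · field_simp; ring
            · field_simp
          rw [e]
          exact H _ hx _ hy
        simp only [Set.indicator, mem_preimage, hx, hy, this]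
        simp
      · simp [Set.indicator, hy, ht0]
    · simp [Set.indicator, hx, sub_pos.2 ht1])
  rw [vol a _ ha h₁, vol b _ hb h₂, vol (a + b) _ hab h, hK₁, hK₂,
    ← ENNReal.ofReal_mul (by positivity), ← ENNReal.ofReal_mul (by positivity),
    inv_mul_cancel₀ (by positivity), inv_mul_cancel₀ (by positivity)] at main
  simp only [ENNReal.ofReal_one, ENNReal.one_rpow, mul_one] at main
  have := mul_le_mul_right main (ENNReal.ofReal ((a + b) ^ (d + 1)))
  rwa [mul_one, ← mul_assoc, ← ENNReal.ofReal_mul (by positivity),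
    mul_inv_cancel₀ (by positivity), ENNReal.ofReal_one, one_mul] at this

theorem concave_bddAbove {E : Type*} [NormedAddCommGroup E] [NormedSpace ℝ E]
    [FiniteDimensional ℝ E] {D : Set E} (hD : IsCompact D) (hi : (interior D).Nonempty)
    {G : E → ℝ} (hG : ConcaveOn ℝ D G) : ∃ M, ∀ x ∈ D, G x ≤ M := by
  obtain ⟨x₀, hx₀⟩ := hi
  have hc : ContinuousAt G x₀ :=
    hG.continuousOn_interior.continuousAt (isOpen_interior.mem_nhds hx₀)
  have ev : ∀ᶠ z in nhds x₀, G x₀ - 1 < G z ∧ z ∈ D :=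
    (hc.eventually_const_lt (by linarith)).and (mem_interior_iff_mem_nhds.1 hx₀)
  obtain ⟨r, hr, hball⟩ := Metric.eventually_nhds_iff.1 ev
  obtain ⟨R, hR, hDR⟩ := hD.isBounded.exists_pos_norm_le
  have hS : 0 < R + ‖x₀‖ := by positivity
  set ε := r / (2 * (R + ‖x₀‖)) with hε
  have ε0 : 0 < ε := by positivity
  refine ⟨((1 + ε) * G x₀ - (G x₀ - 1)) / ε, fun x hx => ?_⟩
  obtain ⟨hz1, hz2⟩ := hball (y := x₀ - ε • (x - x₀)) (by
    rw [dist_eq_norm, sub_sub_cancel_left, norm_neg, norm_smul, Real.norm_of_nonneg ε0.le]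
    have : ‖x - x₀‖ ≤ R + ‖x₀‖ := (norm_sub_le _ _).trans (by gcongr; exact hDR x hx)
    calc ε * ‖x - x₀‖ ≤ ε * (R + ‖x₀‖) := by gcongr
      _ = r / 2 := by rw [hε]; field_simp
      _ < r := by linarith)
  have h1e : 0 < 1 + ε := by positivity
  have hconc := hG.2
  have := hconc hz2 hx (show 0 ≤ 1 / (1 + ε) by positivity) (show 0 ≤ ε / (1 + ε) by positivity)
    (by field_simp)
  have e : (1 / (1 + ε)) • (x₀ - ε • (x - x₀)) + (ε / (1 + ε)) • x = x₀ := by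
    have : x₀ = ((1 + ε) / (1 + ε)) • x₀ := by rw [div_self h1e.ne', one_smul]
    conv_rhs => rw [this]
    module
  rw [e] at this
  simp only [smul_eq_mul] at this
  have h3 : G (x₀ - ε • (x - x₀)) + ε * G x ≤ (1 + ε) * G x₀ := by
    have := mul_le_mul_of_nonneg_left this h1e.le
    field_simp at this
    linarith
  rw [le_div_iff₀ ε0]
  linarith

theorem hypograph_facts {d : ℕ} {D : Set (EuclideanSpace ℝ (Fin d))} (hD : IsCompact D)
    (hi : (interior D).Nonempty) {G : EuclideanSpace ℝ (Fin d) → ℝ} (hG : ConcaveOn ℝ D G) :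
    MeasurableSet (regionBetween (fun _ => 0) G (interior D)) ∧
    volume (regionBetween (fun _ => 0) G (interior D)) =
      ENNReal.ofReal (∫ x in D, max (G x) 0) := by
  have hc := hG.continuousOn_interior
  have hm : AEMeasurable G (volume.restrict (interior D)) :=
    hc.aemeasurable isOpen_interior.measurableSet
  constructor
  · have h1 : ContinuousOn (fun p : EuclideanSpace ℝ (Fin d) × ℝ => G p.1 - p.2)
        (interior D ×ˢ Ioi 0) :=
      (hc.comp continuousOn_fst fun p hp => hp.1).sub continuousOn_snd
    have h2 := h1.isOpen_inter_preimage (isOpen_interior.prod isOpen_Ioi) (isOpen_Ioi (a := 0))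
    convert h2.measurableSet using 1
    ext p
    simp [regionBetween, and_assoc]
  · have hae : interior D =ᵐ[volume] D := by
      refine interior_ae_eq_of_null_frontier (hG.1.addHaar_frontier volume)
    rw [Measure.volume_eq_prod, volume_regionBetween_eq_lintegral aemeasurable_const hm
      isOpen_interior.measurableSet, ← setIntegral_congr_set hae,
      ofReal_integral_eq_lintegral_ofReal]
    · refine lintegral_congr fun x => ?_
      simp
    · obtain ⟨M, hM⟩ := concave_bddAbove hD hi hG
      have : IsFiniteMeasure (volume.restrict (interior D)) :=
        ⟨by simpa using (measure_mono interior_subset).trans_lt hD.measure_lt_top⟩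
      refine Integrable.of_bound ?_ (max M 0) ?_
      · exact (hm.max aemeasurable_const).aestronglyMeasurable
      · refine (ae_restrict_iff' isOpen_interior.measurableSet).2 (.of_forall fun x hx => ?_)
        rw [Real.norm_of_nonneg (le_max_right _ _)]
        exact max_le_max_right _ (hM x (interior_subset hx))
    · exact .of_forall fun x => le_max_right _ _

end PLaux


open Pointwise

/-- Brunn–Minkowski type inequality for integrals of positive parts of
superadditive concave functions on convex bodies: if `G` on `Δ₁ + Δ₂` dominates the sum
of concave `G₁`, `G₂` on convex bodies `Δ₁`, `Δ₂` in `ℝ^d`, and the integrals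
`vᵢ = ∫_{Δᵢ} max (Gᵢ, 0)` are positive, then
`v^{1/(d+1)} ≥ v₁^{1/(d+1)} + v₂^{1/(d+1)}` where `v = ∫_{Δ₁+Δ₂} max (G, 0)`. -/
theorem rpow_integral_posPart_superadditive
    (d : ℕ) (hd : 1 ≤ d)
    (Δ₁ Δ₂ : Set (EuclideanSpace ℝ (Fin d)))
    (h₁cpt : IsCompact Δ₁) (h₁conv : Convex ℝ Δ₁) (h₁int : (interior Δ₁).Nonempty)
    (h₂cpt : IsCompact Δ₂) (h₂conv : Convex ℝ Δ₂) (h₂int : (interior Δ₂).Nonempty)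
    (G₁ G₂ G : EuclideanSpace ℝ (Fin d) → ℝ)
    (hG₁ : ConcaveOn ℝ Δ₁ G₁) (hG₂ : ConcaveOn ℝ Δ₂ G₂)
    (hG : ConcaveOn ℝ (Δ₁ + Δ₂) G)
    (hsuper : ∀ x ∈ Δ₁, ∀ y ∈ Δ₂, G₁ x + G₂ y ≤ G (x + y))
    (hv₁ : 0 < ∫ x in Δ₁, max (G₁ x) 0)
    (hv₂ : 0 < ∫ x in Δ₂, max (G₂ x) 0) :
    (∫ x in Δ₁, max (G₁ x) 0) ^ (1 / (d + 1 : ℝ)) +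
        (∫ x in Δ₂, max (G₂ x) 0) ^ (1 / (d + 1 : ℝ)) ≤
      (∫ x in Δ₁ + Δ₂, max (G x) 0) ^ (1 / (d + 1 : ℝ)) := by

  have i12 : interior Δ₁ + interior Δ₂ ⊆ interior (Δ₁ + Δ₂) :=
    interior_maximal (Set.add_subset_add interior_subset interior_subset)
      (isOpen_interior.add_right)
  have hsumint : (interior (Δ₁ + Δ₂)).Nonempty := (h₁int.add h₂int).mono i12
  obtain ⟨m₁, e₁⟩ := hypograph_facts h₁cpt h₁int hG₁
  obtain ⟨m₂, e₂⟩ := hypograph_facts h₂cpt h₂int hG₂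
  obtain ⟨m, e⟩ := hypograph_facts (h₁cpt.add h₂cpt) hsumint hG
  have hd0 : (0 : ℝ) < (d : ℝ) + 1 := by positivity
  have pw : ∀ v : ℝ, 0 < v → (v ^ (1 / (d + 1 : ℝ))) ^ (d + 1) = v := by
    intro v hv
    rw [← Real.rpow_natCast, ← Real.rpow_mul hv.le]
    push_cast
    rw [one_div_mul_cancel hd0.ne', Real.rpow_one]
  have a0 := Real.rpow_pos_of_pos hv₁ (1 / (d + 1 : ℝ))
  have b0 := Real.rpow_pos_of_pos hv₂ (1 / (d + 1 : ℝ))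
  have main := bm_prod d _ _ _ m₁ m₂ m (by
    rintro ⟨x, s⟩ ⟨hx, hs⟩ ⟨y, u⟩ ⟨hy, hu⟩
    refine ⟨i12 (Set.add_mem_add hx hy), ?_⟩
    have := hsuper x (interior_subset hx) y (interior_subset hy)
    simp only [Set.mem_Ioo, Prod.fst_add, Prod.snd_add] at hs hu ⊢
    constructor <;> linarith) a0 b0 (by rw [pw _ hv₁, e₁]) (by rw [pw _ hv₂, e₂])
  rw [e] at main
  have hv0 : 0 ≤ ∫ x in Δ₁ + Δ₂, max (G x) 0 :=
    MeasureTheory.integral_nonneg fun x => le_max_right _ _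
  rw [ENNReal.ofReal_le_ofReal_iff hv0, ← Real.rpow_natCast] at main
  have := Real.rpow_le_rpow (by positivity) main (z := 1 / (d + 1 : ℝ)) (by positivity)
  rwa [← Real.rpow_mul (by positivity), Nat.cast_add, Nat.cast_one,
    mul_one_div_cancel hd0.ne', Real.rpow_one] at this
end

section
/- Let d ≥ 1, let Δ ⊆ ℝ^d be a convex body, and let (Δ_j)_{j∈ℕ} be a non-increasing sequence of convex bodies (Δ_{j+1} ⊆ Δ_j) each containing Δ. For each j let f_j : int(Δ_j) → ℝ be a concave function, and let f : int(Δ) → ℝ be a concave function. Assume that f_{j+1} ≤ f_j on int(Δ_{j+1}) and f ≤ f_j on int(Δ) for every j, and that for every real number α ≥ 0 one has lim_{j→∞} ∫_{int(Δ_j)} max(f_j(λ) + α, 0) dλ = ∫_{int(Δ)} max(f(λ) + α, 0) dλ, the integrals being with respect to d-dimensional Lebesgue measure (these integrals are finite since a concave function on a bounded open convex set is bounded above). Then lim_{j→∞} f_j(λ) = f(λ) for every λ ∈ int(Δ). -/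
open MeasureTheory in
lemma concave_pos_part_integrable {d : ℕ} {U : Set (EuclideanSpace ℝ (Fin d))}
    (hU : IsOpen U) (hb : Bornology.IsBounded U) (hne : U.Nonempty)
    {g : EuclideanSpace ℝ (Fin d) → ℝ} (hg : ConcaveOn ℝ U g) (α : ℝ) :
    IntegrableOn (fun x => max (g x + α) 0) U := by
  have hc : ContinuousOn g U := hg.continuousOn hU
  obtain ⟨x0, hx0⟩ := hne
  have hev : ∀ᶠ y in nhds x0, y ∈ U ∧ g x0 - 1 < g y :=
    Filter.Eventually.and (hU.mem_nhds hx0)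
      ((hc.continuousAt (hU.mem_nhds hx0)).eventually (lt_mem_nhds (by linarith)))
  obtain ⟨r, hr, hball⟩ := Metric.eventually_nhds_iff.1 hev
  obtain ⟨D, hD⟩ := hb.subset_closedBall x0
  have hbd : ∃ M, ∀ y ∈ U, g y ≤ M := by
    set E := max D 1 with hE
    have hE1 : 0 < E := lt_of_lt_of_le one_pos (le_max_right _ _)
    set t := r / (2 * E) with ht
    have ht0 : 0 < t := by positivity
    refine ⟨((1 + t) * g x0 - (g x0 - 1)) / t, fun y hy => ?_⟩
    have hyd : ‖y - x0‖ ≤ E := by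
      have := hD hy
      rw [Metric.mem_closedBall, dist_eq_norm] at this
      exact this.trans (le_max_left _ _)
    have hz := @hball (x0 - t • (y - x0)) (by
      rw [dist_eq_norm, sub_sub_cancel_left, norm_neg, norm_smul, Real.norm_of_nonneg ht0.le]
      calc t * ‖y - x0‖ ≤ t * E := by gcongr
        _ = r / 2 := by rw [ht]; field_simp
        _ < r := by linarith)
    have h1 := hg.2 hy hz.1 (by positivity : 0 ≤ t / (1 + t))
      (by positivity : 0 ≤ 1 / (1 + t)) (by field_simp; ring)
    have he : (t / (1 + t)) • y + (1 / (1 + t)) • (x0 - t • (y - x0)) = x0 := by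
      ext i
      simp
      field_simp
      ring
    rw [he] at h1
    simp only [smul_eq_mul] at h1
    have h2 : t * g y + g (x0 - t • (y - x0)) ≤ (1 + t) * g x0 := by
      have := mul_le_mul_of_nonneg_left h1 (by positivity : 0 ≤ 1 + t)
      calc _ = (1 + t) * (t / (1 + t) * g y + 1 / (1 + t) * g (x0 - t • (y - x0))) := by
            field_simp
        _ ≤ _ := this
    rw [le_div_iff₀ ht0]
    linarith [hz.2]
  obtain ⟨M, hM⟩ := hbd
  refine IntegrableOn.of_bound hb.measure_lt_top ?_ (max (M + α) 0) ?_
  · exact ((hc.add continuousOn_const).sup continuousOn_const).aestronglyMeasurable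
      hU.measurableSet
  · filter_upwards [ae_restrict_mem hU.measurableSet] with y hy
    rw [Real.norm_of_nonneg (le_max_right _ _)]
    exact max_le_max (by linarith [hM y hy]) le_rfl

/-- Let `Δseq` be a non-increasing sequence of convex bodies containing the
convex body `Δ`, let `fseq j` be concave on `interior (Δseq j)` and `f` concave on
`interior Δ`, with `fseq (j+1) ≤ fseq j` on `interior (Δseq (j+1))` and `f ≤ fseq j` on
`interior Δ`.  If for every `α ≥ 0` the integrals `∫_{int Δseq j} max (fseq j + α) 0`
converge to `∫_{int Δ} max (f + α) 0`, then `fseq j → f` pointwise on `interior Δ`. -/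
theorem tendsto_concave_of_integral_tendsto_antitone
    (d : ℕ) (hd : 1 ≤ d)
    (Δ : Set (EuclideanSpace ℝ (Fin d)))
    (hΔcpt : IsCompact Δ) (hΔconv : Convex ℝ Δ) (hΔint : (interior Δ).Nonempty)
    (Δseq : ℕ → Set (EuclideanSpace ℝ (Fin d)))
    (hcpt : ∀ j, IsCompact (Δseq j)) (hconv : ∀ j, Convex ℝ (Δseq j))
    (hint : ∀ j, (interior (Δseq j)).Nonempty)
    (hdec : ∀ j, Δseq (j + 1) ⊆ Δseq j)
    (hsub : ∀ j, Δ ⊆ Δseq j)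
    (fseq : ℕ → EuclideanSpace ℝ (Fin d) → ℝ)
    (f : EuclideanSpace ℝ (Fin d) → ℝ)
    (hfseqconc : ∀ j, ConcaveOn ℝ (interior (Δseq j)) (fseq j))
    (hfconc : ConcaveOn ℝ (interior Δ) f)
    (hfdec : ∀ j, ∀ x ∈ interior (Δseq (j + 1)), fseq (j + 1) x ≤ fseq j x)
    (hfle : ∀ j, ∀ x ∈ interior Δ, f x ≤ fseq j x)
    (hinttendsto : ∀ α : ℝ, 0 ≤ α →
      Filter.Tendsto (fun j => ∫ x in interior (Δseq j), max (fseq j x + α) 0)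
        Filter.atTop (nhds (∫ x in interior Δ, max (f x + α) 0))) :
    ∀ x ∈ interior Δ,
      Filter.Tendsto (fun j => fseq j x) Filter.atTop (nhds (f x)) := by
  intro x hx
  have hsubi : ∀ j, interior Δ ⊆ interior (Δseq j) := fun j => interior_mono (hsub j)
  have hanti : Antitone (fun j => fseq j x) :=
    antitone_nat_of_succ_le fun j => hfdec j x (hsubi _ hx)
  rw [Metric.tendsto_atTop]
  by_contra hcon
  push Not at hcon
  obtain ⟨ε, hε, hcon⟩ := hcon
  have hge : ∀ j, f x + ε ≤ fseq j x := by
    intro j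
    obtain ⟨n, hn, hn'⟩ := hcon j
    rw [Real.dist_eq, abs_of_nonneg (by linarith [hfle n x hx])] at hn'
    have : fseq n x ≤ fseq j x := hanti hn
    linarith
  have hc : ContinuousOn f (interior Δ) := hfconc.continuousOn isOpen_interior
  have hev : ∀ᶠ y in nhds x, y ∈ interior Δ ∧ dist (f y) (f x) < ε / 6 :=
    Filter.Eventually.and (isOpen_interior.mem_nhds hx)
      ((hc.continuousAt (isOpen_interior.mem_nhds hx)).eventually
        (Metric.ball_mem_nhds _ (by positivity)))
  obtain ⟨r, hr, hball⟩ := Metric.eventually_nhds_iff.1 hev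
  have hfb : ∀ y, dist y x < r → f x - ε / 6 < f y ∧ f y < f x + ε / 6 := by
    intro y hy
    have := (hball hy).2
    rw [Real.dist_eq, abs_lt] at this
    constructor <;> linarith [this.1, this.2]
  set B := Metric.ball x (r / 2) with hB
  have hBsub : B ⊆ interior Δ := fun y hy =>
    (hball (lt_of_lt_of_le (Metric.mem_ball.1 hy) (by linarith))).1
  have hgap : ∀ j, ∀ y ∈ B, f y + ε / 4 ≤ fseq j y := by
    intro j y hy
    have hyd := Metric.mem_ball.1 hy
    have hzd : dist (x + (2 : ℝ) • (y - x)) x < r := by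
      rw [dist_eq_norm, add_sub_cancel_left, norm_smul, ← dist_eq_norm]
      norm_num
      linarith
    have hz := (hball hzd).1
    have h1 := (hfseqconc j).2 (hsubi j hx) (hsubi j hz)
      (by norm_num : (0 : ℝ) ≤ 1 / 2) (by norm_num : (0 : ℝ) ≤ 1 / 2) (by norm_num)
    have he : (1 / 2 : ℝ) • x + (1 / 2 : ℝ) • (x + (2 : ℝ) • (y - x)) = y := by
      ext i
      simp
      ring
    rw [he] at h1
    simp only [smul_eq_mul] at h1
    linarith [hge j, hfle j _ hz, (hfb _ hzd).1, (hfb y (by linarith)).2]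
  set α := |f x| + ε / 6 with hα
  have hα0 : 0 ≤ α := by positivity
  have hI : ∀ j, MeasureTheory.IntegrableOn (fun y => max (fseq j y + α) 0)
      (interior (Δseq j)) := fun j =>
    concave_pos_part_integrable isOpen_interior ((hcpt j).isBounded.subset interior_subset)
      (hint j) (hfseqconc j) α
  have hIf : MeasureTheory.IntegrableOn (fun y => max (f y + α) 0) (interior Δ) :=
    concave_pos_part_integrable isOpen_interior (hΔcpt.isBounded.subset interior_subset)
      hΔint hfconc α
  set V := MeasureTheory.volume.real B with hV
  have hVpos : 0 < V := ENNReal.toReal_pos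
    (Metric.measure_ball_pos _ _ (by positivity)).ne' MeasureTheory.measure_ball_lt_top.ne
  have hIB : MeasureTheory.IntegrableOn (B.indicator fun _ => ε / 4) (interior Δ) :=
    ((MeasureTheory.integrable_indicator_iff Metric.isOpen_ball.measurableSet).2
      (MeasureTheory.integrableOn_const MeasureTheory.measure_ball_lt_top.ne)).integrableOn
  have hkey : ∀ j, (∫ y in interior Δ, max (f y + α) 0) + V * (ε / 4) ≤
      ∫ y in interior (Δseq j), max (fseq j y + α) 0 := by
    intro j
    have e1 : ∫ y in interior Δ, B.indicator (fun _ => ε / 4) y = V * (ε / 4) := by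
      rw [MeasureTheory.setIntegral_indicator Metric.isOpen_ball.measurableSet,
        Set.inter_eq_right.2 hBsub, MeasureTheory.setIntegral_const, smul_eq_mul]
    rw [← e1, ← MeasureTheory.integral_add hIf hIB]
    refine le_trans ?_ (MeasureTheory.setIntegral_mono_set (hI j)
      (Filter.Eventually.of_forall fun y => le_max_right _ _)
      (LE.le.eventuallyLE (hsubi j)))
    refine MeasureTheory.setIntegral_mono_on (hIf.add hIB) ((hI j).mono_set (hsubi j))
      isOpen_interior.measurableSet ?_
    intro y hy
    by_cases hyB : y ∈ B
    · rw [Set.indicator_of_mem hyB]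
      have h1 := hgap j y hyB
      have h2 := (hfb y (by linarith [Metric.mem_ball.1 hyB])).1
      have h3 := neg_abs_le (f x)
      rw [max_eq_left (by linarith)]
      exact le_trans (by linarith) (le_max_left _ _)
    · rw [Set.indicator_of_notMem hyB, add_zero]
      exact max_le_max (by linarith [hfle j y hy]) le_rfl
  have := ge_of_tendsto' (hinttendsto α hα0) hkey
  have : 0 < V * (ε / 4) := by positivity
  linarith
end

section
/- Let d ≥ 1, let Δ ⊆ ℝ^d be a convex body, and let (Δ_j)_{j∈ℕ} be a non-decreasing sequence of convex bodies (Δ_j ⊆ Δ_{j+1}) contained in Δ such that ⋃_{j} int(Δ_j) = int(Δ). For each j let f_j : int(Δ_j) → ℝ be a concave function, and let f : int(Δ) → ℝ be a concave function. Assume that f_j ≤ f_{j+1} on int(Δ_j) and f_j ≤ f on int(Δ_j) for every j, and that for every real number α ≥ 0 one has lim_{j→∞} ∫_{int(Δ_j)} max(f_j(λ) + α, 0) dλ = ∫_{int(Δ)} max(f(λ) + α, 0) dλ, the integrals being with respect to d-dimensional Lebesgue measure (these integrals are finite since a concave function on a bounded open convex set is bounded above). Then for every λ ∈ int(Δ),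 the point λ lies in int(Δ_j) for all sufficiently large j and lim_{j→∞} f_j(λ) = f(λ). -/
open Filter Topology MeasureTheory Set in
theorem concave_bddAbove_aux {d : ℕ} {Δ : Set (EuclideanSpace ℝ (Fin d))}
    (hb : Bornology.IsBounded Δ) (hne : (interior Δ).Nonempty)
    (f : EuclideanSpace ℝ (Fin d) → ℝ) (hf : ConcaveOn ℝ (interior Δ) f)
    (hc : ContinuousOn f (interior Δ)) :
    ∃ M : ℝ, ∀ y ∈ interior Δ, f y ≤ M := by
  obtain ⟨x, hx⟩ := hne
  have h1 : ∀ᶠ z in 𝓝 x, f x - 1 < f z ∧ z ∈ interior Δ :=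
    ((hc.continuousAt (isOpen_interior.mem_nhds hx)).eventually
      (lt_mem_nhds (by linarith))).and (isOpen_interior.mem_nhds hx)
  obtain ⟨r, hr, hball⟩ := Metric.eventually_nhds_iff.1 h1
  obtain ⟨R, hR⟩ := hb.subset_ball x
  have hRpos : 0 < R := by
    have := hR (interior_subset hx)
    simpa using this
  set t : ℝ := r / R with ht
  have htpos : 0 < t := by positivity
  refine ⟨f x + 1 / t, fun y hy => ?_⟩
  have hyR : ‖y - x‖ < R := by
    have := hR (interior_subset hy)
    simpa [dist_eq_norm] using this
  have hz := @hball (x - t • (y - x)) (by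
    rw [dist_eq_norm]
    have : x - t • (y - x) - x = -(t • (y - x)) := by abel
    rw [this, norm_neg, norm_smul, Real.norm_of_nonneg htpos.le]
    calc t * ‖y - x‖ < t * R := by gcongr
      _ = r := by rw [ht]; field_simp)
  have h1t : 0 < 1 + t := by linarith
  have hcc := hf.2 hy hz.2 (show 0 ≤ t / (1 + t) by positivity)
    (show 0 ≤ 1 / (1 + t) by positivity) (by field_simp; ring)
  have heq : (t / (1 + t)) • y + (1 / (1 + t)) • (x - t • (y - x)) = x := by
    ext i
    simp
    field_simp
    ring
  rw [heq] at hcc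
  simp only [smul_eq_mul] at hcc
  have h2 : t * f y + f (x - t • (y - x)) ≤ (1 + t) * f x := by
    have := mul_le_mul_of_nonneg_left hcc h1t.le
    calc _ = (1 + t) * (t / (1 + t) * f y + 1 / (1 + t) * f (x - t • (y - x))) := by field_simp
      _ ≤ _ := this
  have h3 : t * f y ≤ t * (f x + 1 / t) := by
    have : t * (f x + 1 / t) = t * f x + 1 := by field_simp
    rw [this]
    nlinarith [hz.1]
  exact le_of_mul_le_mul_left h3 htpos

/-- Let `Δseq` be a non-decreasing sequence of convex bodies contained in
the convex body `Δ` with `⋃ j, interior (Δseq j) = interior Δ`, let `fseq j` be concave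
on `interior (Δseq j)` and `f` concave on `interior Δ`, with `fseq j ≤ fseq (j+1)` and
`fseq j ≤ f` on `interior (Δseq j)`.  If for every `α ≥ 0` the integrals
`∫_{int Δseq j} max (fseq j + α) 0` converge to `∫_{int Δ} max (f + α) 0`, then for each
`x ∈ interior Δ`, `x` lies in `interior (Δseq j)` for all large `j` and
`fseq j x → f x`. -/
theorem tendsto_concave_of_integral_tendsto_monotone
    (d : ℕ) (hd : 1 ≤ d)
    (Δ : Set (EuclideanSpace ℝ (Fin d)))
    (hΔcpt : IsCompact Δ) (hΔconv : Convex ℝ Δ) (hΔint : (interior Δ).Nonempty)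
    (Δseq : ℕ → Set (EuclideanSpace ℝ (Fin d)))
    (hcpt : ∀ j, IsCompact (Δseq j)) (hconv : ∀ j, Convex ℝ (Δseq j))
    (hint : ∀ j, (interior (Δseq j)).Nonempty)
    (hinc : ∀ j, Δseq j ⊆ Δseq (j + 1))
    (hsub : ∀ j, Δseq j ⊆ Δ)
    (hunion : ⋃ j, interior (Δseq j) = interior Δ)
    (fseq : ℕ → EuclideanSpace ℝ (Fin d) → ℝ)
    (f : EuclideanSpace ℝ (Fin d) → ℝ)
    (hfseqconc : ∀ j, ConcaveOn ℝ (interior (Δseq j)) (fseq j))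
    (hfconc : ConcaveOn ℝ (interior Δ) f)
    (hfinc : ∀ j, ∀ x ∈ interior (Δseq j), fseq j x ≤ fseq (j + 1) x)
    (hfle : ∀ j, ∀ x ∈ interior (Δseq j), fseq j x ≤ f x)
    (hinttendsto : ∀ α : ℝ, 0 ≤ α →
      Filter.Tendsto (fun j => ∫ x in interior (Δseq j), max (fseq j x + α) 0)
        Filter.atTop (nhds (∫ x in interior Δ, max (f x + α) 0))) :
    ∀ x ∈ interior Δ,
      (∃ J : ℕ, ∀ j ≥ J, x ∈ interior (Δseq j)) ∧
        Filter.Tendsto (fun j => fseq j x) Filter.atTop (nhds (f x)) := by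
  have hmono : Monotone Δseq := monotone_nat_of_le_succ hinc
  have hmem : ∀ x ∈ interior Δ, ∃ J : ℕ, ∀ j ≥ J, x ∈ interior (Δseq j) := by
    intro x hx
    rw [← hunion] at hx
    obtain ⟨J, hJ⟩ := Set.mem_iUnion.1 hx
    exact ⟨J, fun j hj => interior_mono (hmono hj) hJ⟩
  have hsubint : ∀ j, interior (Δseq j) ⊆ interior Δ := fun j => interior_mono (hsub j)
  have hfmono : ∀ i, ∀ x ∈ interior (Δseq i), ∀ j, i ≤ j → fseq i x ≤ fseq j x := by
    intro i x hx j hij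
    induction j, hij using Nat.le_induction with
    | base => exact le_rfl
    | succ n hn ih => exact ih.trans (hfinc n x (interior_mono (hmono hn) hx))
  have hlim : ∀ x, ∃ l : ℝ, x ∈ interior Δ →
      Filter.Tendsto (fun j => fseq j x) Filter.atTop (nhds l) := by
    intro x
    by_cases hx : x ∈ interior Δ
    · obtain ⟨J, hJ⟩ := hmem x hx
      have hm : Monotone (fun k => fseq (k + J) x) := by
        intro a b hab
        exact hfmono _ x (hJ _ (by omega)) _ (by omega)
      have hbd : BddAbove (Set.range (fun k => fseq (k + J) x)) :=
        ⟨f x, by rintro _ ⟨k, rfl⟩; exact hfle _ x (hJ _ (by omega))⟩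
      exact ⟨_, fun _ => (Filter.tendsto_add_atTop_iff_nat J).1 (tendsto_atTop_ciSup hm hbd)⟩
    · exact ⟨0, fun h => absurd h hx⟩
  choose g hg using hlim
  have hgf : ∀ x ∈ interior Δ, g x ≤ f x := by
    intro x hx
    obtain ⟨J, hJ⟩ := hmem x hx
    exact le_of_tendsto (hg x hx) (Filter.eventually_atTop.2 ⟨J, fun j hj => hfle j x (hJ j hj)⟩)
  have hfg : ∀ j, ∀ x ∈ interior (Δseq j), fseq j x ≤ g x := by
    intro j x hx
    exact ge_of_tendsto (hg x (hsubint j hx))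
      (Filter.eventually_atTop.2 ⟨j, fun k hk => hfmono j x hx k hk⟩)
  have hgconc : ConcaveOn ℝ (interior Δ) g := by
    refine ⟨hΔconv.interior, fun x hx y hy a b ha hb hab => ?_⟩
    have hz := hΔconv.interior hx hy ha hb hab
    obtain ⟨J, hJ⟩ := hmem x hx
    obtain ⟨K, hK⟩ := hmem y hy
    refine le_of_tendsto_of_tendsto (((hg x hx).const_smul a).add ((hg y hy).const_smul b))
      (hg _ hz) (Filter.eventually_atTop.2 ⟨max J K, fun j hj => ?_⟩)
    exact (hfseqconc j).2 (hJ j (le_of_max_le_left hj)) (hK j (le_of_max_le_right hj)) ha hb hab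
  have hfcont : ContinuousOn f (interior Δ) := hfconc.continuousOn isOpen_interior
  have hgcont : ContinuousOn g (interior Δ) := hgconc.continuousOn isOpen_interior
  have hmeas : MeasurableSet (interior Δ) := isOpen_interior.measurableSet
  have hfin : MeasureTheory.volume (interior Δ) < ⊤ :=
    (MeasureTheory.measure_mono interior_subset).trans_lt hΔcpt.measure_lt_top
  obtain ⟨M, hM⟩ := concave_bddAbove_aux hΔcpt.isBounded hΔint f hfconc hfcont
  have hcm : ∀ h : EuclideanSpace ℝ (Fin d) → ℝ, ContinuousOn h (interior Δ) → ∀ α : ℝ,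
      ContinuousOn (fun x => max (h x + α) 0) (interior Δ) := by
    intro h hc α
    fun_prop
  have hintg : ∀ h : EuclideanSpace ℝ (Fin d) → ℝ, ContinuousOn h (interior Δ) →
      (∀ x ∈ interior Δ, h x ≤ f x) → ∀ α : ℝ,
      MeasureTheory.IntegrableOn (fun x => max (h x + α) 0) (interior Δ) := by
    intro h hc hle α
    have hc' : ContinuousOn (fun x => max (h x + α) 0) (interior Δ) :=
      hcm h hc α
    refine MeasureTheory.IntegrableOn.of_bound hfin
      (hc'.aestronglyMeasurable hmeas) (max (M + α) 0) ?_
    refine (MeasureTheory.ae_restrict_iff' hmeas).2 (Filter.Eventually.of_forall fun x hx => ?_)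
    rw [Real.norm_of_nonneg (le_max_right _ _)]
    exact max_le_max (by linarith [hle x hx, hM x hx]) le_rfl
  intro x hx
  refine ⟨hmem x hx, ?_⟩
  suffices hgx : g x = f x by
    rw [← hgx]
    exact hg x hx
  set α : ℝ := |f x| + 1 with hα
  have hα0 : 0 ≤ α := by positivity
  have hif := hintg f hfcont (fun _ _ => le_rfl) α
  have hig := hintg g hgcont hgf α
  have hle1 : ∫ y in interior Δ, max (f y + α) 0 ≤ ∫ y in interior Δ, max (g y + α) 0 := by
    refine le_of_tendsto (hinttendsto α hα0) (Filter.Eventually.of_forall fun j => ?_)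
    calc ∫ y in interior (Δseq j), max (fseq j y + α) 0
        ≤ ∫ y in interior (Δseq j), max (g y + α) 0 := by
          refine MeasureTheory.integral_mono_of_nonneg
            (Filter.Eventually.of_forall fun y => le_max_right _ _) (hig.mono_set (hsubint j)) ?_
          refine (MeasureTheory.ae_restrict_iff' isOpen_interior.measurableSet).2
            (Filter.Eventually.of_forall fun y hy => ?_)
          exact max_le_max (by linarith [hfg j y hy]) le_rfl
      _ ≤ ∫ y in interior Δ, max (g y + α) 0 :=
          MeasureTheory.setIntegral_mono_set hig
            (Filter.Eventually.of_forall fun y => le_max_right _ _)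
            (Filter.Eventually.of_forall (hsubint j))
  have hae : (fun y => max (g y + α) 0) ≤ᵐ[MeasureTheory.volume.restrict (interior Δ)]
      (fun y => max (f y + α) 0) :=
    (MeasureTheory.ae_restrict_iff' hmeas).2 (Filter.Eventually.of_forall fun y hy =>
      max_le_max (by linarith [hgf y hy]) le_rfl)
  have hinteq := le_antisymm (MeasureTheory.integral_mono_ae hig hif hae) hle1
  have haeeq := (MeasureTheory.integral_eq_iff_of_ae_le hig hif hae).1 hinteq
  have heq := MeasureTheory.Measure.eqOn_open_of_ae_eq haeeq isOpen_interior
    (hcm g hgcont α)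
    (hcm f hfcont α) hx
  have hpos : 0 < f x + α := by
    rw [hα]
    linarith [neg_abs_le (f x)]
  simp only at heq
  rw [max_eq_left hpos.le] at heq
  rcases max_choice (g x + α) 0 with h | h
  · rw [h] at heq
    linarith
  · rw [h] at heq
    linarith
end
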